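/- arXiv:1708.08781 — 2 statements merged into one kernel-verified Lean document; each statement's English description precedes it below -/
import Mathlib

section
/- Let F : 2^V → ℝ^E be a submodular transformation on a finite set V with |V| = n ≥ 2 such that F(∅) = 0 and F(V) = 0. Then the Laplacian L_F has a non-trivial eigenpair: there exist γ ≥ 0 and a nonzero vector z ∈ ℝ^V with ⟨z, 1⟩ = 0 such that γ z ∈ L_F(z). Furthermore, every γ ∈ ℝ and nonzero z ∈ ℝ^V with ⟨z, 1⟩ = 0 and γ z ∈ L_F(z) satisfy γ = (∑_{e∈E} f_e(z)²) / ‖z‖₂². -/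
open Finset

variable {V E : Type*}

/-- A set function on a finite ground set is submodular. -/
def Submodular [DecidableEq V] (F : Finset V → ℝ) : Prop :=
  ∀ S T : Finset V, F (S ∪ T) + F (S ∩ T) ≤ F S + F T

/-- The base polytope of a set function. -/
def basePolytope [Fintype V] (F : Finset V → ℝ) : Set (V → ℝ) :=
  {w | (∀ S : Finset V, ∑ v ∈ S, w v ≤ F S) ∧ ∑ v, w v = F Finset.univ}

/-- The Lovász extension `f(x) = max_{w ∈ B(F)} ⟨w, x⟩`. -/
noncomputable def lovasz [Fintype V] (F : Finset V → ℝ) (x : V → ℝ) : ℝ :=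
  sSup ((fun w : V → ℝ => ∑ v, w v * x v) '' basePolytope F)

/-- `∂f(x) = argmax_{w ∈ B(F)} ⟨w, x⟩`. -/
def subdiff [Fintype V] (F : Finset V → ℝ) (x : V → ℝ) : Set (V → ℝ) :=
  {w | w ∈ basePolytope F ∧ ∀ w' ∈ basePolytope F, ∑ v, w' v * x v ≤ ∑ v, w v * x v}

/-- The submodular Laplacian, a set-valued map. -/
def laplacian [Fintype V] [Fintype E] (F : Finset V → E → ℝ) (x : V → ℝ) : Set (V → ℝ) :=
  {z | ∃ w : E → V → ℝ, (∀ e : E, w e ∈ subdiff (fun S => F S e) x) ∧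
    z = fun v => ∑ e : E, (∑ u, w e u * x u) * w e v}

/-- The support of a set function. -/
def funSupp [DecidableEq V] (G : Finset V → ℝ) : Set V :=
  {v | ∃ S : Finset V, v ∉ S ∧ G (insert v S) ≠ G S}

open Classical in
/-- The degree `d_F(v)` of `v`: the number of coordinate functions to which `v` is relevant. -/
noncomputable def deg [Fintype V] [Fintype E] [DecidableEq V]
    (F : Finset V → E → ℝ) (v : V) : ℝ :=
  ((Finset.univ : Finset E).filter (fun e => v ∈ funSupp (fun S => F S e))).card

/-- `cut_F(S) = ∑_e F_e(S)`. -/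
def cutF [Fintype V] [Fintype E] (F : Finset V → E → ℝ) (S : Finset V) : ℝ := ∑ e : E, F S e

/-- `vol_F(S) = ∑_{v ∈ S} d_F(v)`. -/
noncomputable def volF [Fintype V] [Fintype E] [DecidableEq V]
    (F : Finset V → E → ℝ) (S : Finset V) : ℝ :=
  ∑ v ∈ S, deg F v

/-- The conductance of a set `S`. -/
noncomputable def condOf [Fintype V] [Fintype E] [DecidableEq V]
    (F : Finset V → E → ℝ) (S : Finset V) : ℝ :=
  min (cutF F S) (cutF F Sᶜ) / min (volF F S) (volF F Sᶜ)

/-- The conductance `φ_F` of `F`: minimum over nonempty proper subsets. -/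
noncomputable def conduct [Fintype V] [Fintype E] [DecidableEq V]
    (F : Finset V → E → ℝ) : ℝ :=
  sInf {c | ∃ S : Finset V, S.Nonempty ∧ S ≠ Finset.univ ∧ c = condOf F S}

/-- The Rayleigh quotient of the normalized Laplacian. -/
noncomputable def rayleigh [Fintype V] [Fintype E] [DecidableEq V]
    (F : Finset V → E → ℝ) (x : V → ℝ) : ℝ :=
  (∑ e : E, (lovasz (fun S => F S e) (fun v => x v / Real.sqrt (deg F v)))^2) /
    (∑ v, (x v)^2)

/-- The smallest non-trivial eigenvalue `λ_F`, defined as the infimum of the Rayleigh quotient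
over nonzero vectors orthogonal to `D_F^{1/2} 𝟏`. -/
noncomputable def lambdaF [Fintype V] [Fintype E] [DecidableEq V]
    (F : Finset V → E → ℝ) : ℝ :=
  sInf {r | ∃ x : V → ℝ, x ≠ 0 ∧ (∑ v, x v * Real.sqrt (deg F v)) = 0 ∧ r = rayleigh F x}

open Filter Topology in
theorem aux_mem_Icc {V : Type*} [Fintype V] [DecidableEq V] (G : Finset V → ℝ) (w : V → ℝ)
    (hw : w ∈ basePolytope G) (v : V) :
    w v ∈ Set.Icc (G Finset.univ - G (Finset.univ.erase v)) (G {v}) := by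
  obtain ⟨h1, h2⟩ := hw
  have h3 := h1 {v}
  have h4 := h1 (Finset.univ.erase v)
  have h5 := Finset.add_sum_erase Finset.univ w (Finset.mem_univ v)
  simp only [Finset.sum_singleton] at h3
  constructor <;> linarith

theorem aux_closed {V : Type*} [Fintype V] (G : Finset V → ℝ) : IsClosed (basePolytope G) := by
  have : basePolytope G = (⋂ S : Finset V, {w : V → ℝ | ∑ v ∈ S, w v ≤ G S}) ∩
      {w : V → ℝ | ∑ v, w v = G Finset.univ} := by
    ext w; simp [basePolytope]
  rw [this]
  refine IsClosed.inter (isClosed_iInter fun S => ?_) ?_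
  · exact isClosed_le (by fun_prop) continuous_const
  · exact isClosed_eq (by fun_prop) continuous_const

theorem aux_compact {V : Type*} [Fintype V] [DecidableEq V] (G : Finset V → ℝ) :
    IsCompact (basePolytope G) := by
  refine IsCompact.of_isClosed_subset (isCompact_univ_pi (s := fun v =>
    Set.Icc (G Finset.univ - G (Finset.univ.erase v)) (G {v})) fun v => isCompact_Icc)
    (aux_closed G) ?_
  intro w hw v _
  exact aux_mem_Icc G w hw v

theorem aux_greedy {V : Type*} [DecidableEq V] (G : Finset V → ℝ) (hG : Submodular G)
    (h0 : G ∅ = 0) (A : Finset V) :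
    ∃ w : V → ℝ, (∀ S ⊆ A, ∑ v ∈ S, w v ≤ G S) ∧ ∑ v ∈ A, w v = G A := by
  induction A using Finset.induction_on with
  | empty =>
    refine ⟨0, ?_, by simp [h0]⟩
    intro S hS
    rw [Finset.subset_empty.1 hS]; simp [h0]
  | insert a A ha ih =>
    obtain ⟨w, h1, h2⟩ := ih
    set w' : V → ℝ := Function.update w a (G (insert a A) - G A) with hw'
    have key : ∀ S, a ∉ S → ∑ v ∈ S, w' v = ∑ v ∈ S, w v := by
      intro S hS
      refine Finset.sum_congr rfl fun v hv => ?_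
      rw [hw', Function.update_of_ne]
      rintro rfl; exact hS hv
    have hwa : w' a = G (insert a A) - G A := by simp [hw']
    refine ⟨w', ?_, ?_⟩
    · intro S hS
      by_cases haS : a ∈ S
      · rw [← Finset.add_sum_erase S w' haS, key _ (Finset.notMem_erase a S), hwa]
        have hsub : S.erase a ⊆ A := by
          intro x hx
          have := hS (Finset.mem_of_mem_erase hx)
          rcases Finset.mem_insert.1 this with h | h
          · exact absurd h (Finset.ne_of_mem_erase hx)
          · exact h
        have e1 : S ∪ A = insert a A := by
          ext x
          have := @hS x
          simp only [Finset.mem_union, Finset.mem_insert] at this ⊢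
          constructor
          · rintro (h | h)
            · exact this h
            · exact Or.inr h
          · rintro (h | h)
            · subst h; exact Or.inl haS
            · exact Or.inr h
        have e2 : S ∩ A = S.erase a := by
          ext x
          simp only [Finset.mem_inter, Finset.mem_erase]
          constructor
          · rintro ⟨h, h'⟩
            exact ⟨fun e => ha (e ▸ h'), h⟩
          · rintro ⟨h, h'⟩
            exact ⟨h', hsub (Finset.mem_erase.2 ⟨h, h'⟩)⟩
        have := hG S A
        rw [e1, e2] at this
        have := h1 _ hsub
        linarith
      · rw [key S haS]
        exact h1 S ((Finset.subset_insert_iff_of_notMem haS).1 hS)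
    · rw [Finset.sum_insert ha, key A ha, hwa, h2]; ring

theorem aux_nonempty {V : Type*} [Fintype V] [DecidableEq V] (G : Finset V → ℝ)
    (hG : Submodular G) (h0 : G ∅ = 0) : (basePolytope G).Nonempty := by
  obtain ⟨w, h1, h2⟩ := aux_greedy G hG h0 Finset.univ
  exact ⟨w, fun S => h1 S (Finset.subset_univ S), h2⟩

theorem aux_subdiff_nonempty {V : Type*} [Fintype V] [DecidableEq V] (G : Finset V → ℝ)
    (hG : Submodular G) (h0 : G ∅ = 0) (x : V → ℝ) : (subdiff G x).Nonempty := by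
  obtain ⟨w, hw, hm⟩ := (aux_compact G).exists_isMaxOn (aux_nonempty G hG h0)
    (f := fun w : V → ℝ => ∑ v, w v * x v) (by fun_prop)
  exact ⟨w, hw, fun w' hw' => hm hw'⟩

theorem aux_lovasz_eq {V : Type*} [Fintype V] (G : Finset V → ℝ) (x w : V → ℝ)
    (hw : w ∈ subdiff G x) : lovasz G x = ∑ v, w v * x v := by
  refine IsGreatest.csSup_eq ⟨⟨w, hw.1, rfl⟩, ?_⟩
  rintro _ ⟨w', hw', rfl⟩
  exact hw.2 w' hw'

theorem aux_le_lovasz {V : Type*} [Fintype V] [DecidableEq V] (G : Finset V → ℝ)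
    (hG : Submodular G) (h0 : G ∅ = 0) (x w : V → ℝ)
    (hw : w ∈ basePolytope G) : ∑ v, w v * x v ≤ lovasz G x := by
  obtain ⟨w', hw'⟩ := aux_subdiff_nonempty G hG h0 x
  rw [aux_lovasz_eq G x w' hw']
  exact hw'.2 w hw

theorem aux_lovasz_cont {V : Type*} [Fintype V] [DecidableEq V] (G : Finset V → ℝ) :
    Continuous (lovasz G) := by
  refine (aux_compact G).continuous_sSup (f := fun x w : V → ℝ => ∑ v, w v * x v) ?_
  simp only [Function.HasUncurry.uncurry]
  fun_prop

theorem aux_lovasz_smul {V : Type*} [Fintype V] [DecidableEq V] (G : Finset V → ℝ)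
    (hG : Submodular G) (h0 : G ∅ = 0) (x : V → ℝ) (c : ℝ) (hc : 0 ≤ c) :
    lovasz G (c • x) = c * lovasz G x := by
  obtain ⟨w, hw⟩ := aux_subdiff_nonempty G hG h0 x
  have e : ∀ w' : V → ℝ, ∑ v, w' v * (c • x) v = c * ∑ v, w' v * x v := by
    intro w'
    rw [Finset.mul_sum]
    refine Finset.sum_congr rfl fun v _ => ?_
    simp only [Pi.smul_apply, smul_eq_mul]; ring
  have hw2 : w ∈ subdiff G (c • x) := by
    refine ⟨hw.1, fun w' hw' => ?_⟩
    rw [e, e]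
    exact mul_le_mul_of_nonneg_left (hw.2 w' hw') hc
  rw [aux_lovasz_eq G _ w hw2, aux_lovasz_eq G x w hw, e]

theorem aux_subdiff_compact {V : Type*} [Fintype V] [DecidableEq V] (G : Finset V → ℝ)
    (x : V → ℝ) : IsCompact (subdiff G x) := by
  refine IsCompact.of_isClosed_subset (aux_compact G) ?_ (fun w hw => hw.1)
  have : subdiff G x = basePolytope G ∩
      ⋂ w' : V → ℝ, ⋂ _ : w' ∈ basePolytope G,
        {w : V → ℝ | ∑ v, w' v * x v ≤ ∑ v, w v * x v} := by
    ext w; simp [subdiff]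
  rw [this]
  refine (aux_closed G).inter (isClosed_iInter fun w' => isClosed_iInter fun _ => ?_)
  exact isClosed_le continuous_const (by fun_prop)

theorem aux_subdiff_convex {V : Type*} [Fintype V] (G : Finset V → ℝ)
    (x : V → ℝ) : Convex ℝ (subdiff G x) := by
  intro p hp q hq a b ha hb hab
  have e : ∀ (S : Finset V) (y : V → ℝ), ∑ v ∈ S, (a • p + b • q) v * y v
      = a * ∑ v ∈ S, p v * y v + b * ∑ v ∈ S, q v * y v := by
    intro S y
    rw [Finset.mul_sum, Finset.mul_sum, ← Finset.sum_add_distrib]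
    refine Finset.sum_congr rfl fun v _ => ?_
    simp only [Pi.smul_apply, Pi.add_apply, smul_eq_mul]; ring
  have e1 : ∀ (S : Finset V), ∑ v ∈ S, (a • p + b • q) v
      = a * ∑ v ∈ S, p v + b * ∑ v ∈ S, q v := by
    intro S; simpa using e S 1
  refine ⟨⟨fun S => ?_, ?_⟩, fun w' hw' => ?_⟩
  · rw [e1]
    have h1 := mul_le_mul_of_nonneg_left (hp.1.1 S) ha
    have h2 := mul_le_mul_of_nonneg_left (hq.1.1 S) hb
    have : G S = a * G S + b * G S := by rw [← add_mul, hab, one_mul]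
    linarith
  · rw [e1, hp.1.2, hq.1.2, ← add_mul, hab, one_mul]
  · rw [e]
    have h1 := mul_le_mul_of_nonneg_left (hp.2 w' hw') ha
    have h2 := mul_le_mul_of_nonneg_left (hq.2 w' hw') hb
    have : ∑ v, w' v * x v = a * (∑ v, w' v * x v) + b * ∑ v, w' v * x v := by
      rw [← add_mul, hab, one_mul]
    linarith

open Filter Topology in
/-- directional derivatives along a common subsequence -/
theorem aux_seq {V E : Type*} [Fintype V] [DecidableEq V] [Fintype E]
    (F : Finset V → E → ℝ)
    (hsub : ∀ e : E, Submodular (fun S => F S e))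
    (hEmpty : ∀ e : E, F ∅ e = 0) (z d : V → ℝ) :
    ∃ (w : E → V → ℝ) (t : ℕ → ℝ), (∀ e, w e ∈ subdiff (fun S => F S e) z) ∧
      (∀ n, 0 < t n) ∧ Tendsto t atTop (𝓝 0) ∧
      ∀ e, Tendsto (fun n => (lovasz (fun S => F S e) (z + t n • d)
        - lovasz (fun S => F S e) z) / t n) atTop (𝓝 (∑ v, w e v * d v)) := by
  let s : ℕ → ℝ := fun n => 1 / ((n : ℝ) + 1)
  have hs0 : Tendsto s atTop (𝓝 0) := tendsto_one_div_add_atTop_nhds_zero_nat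
  have hspos : ∀ n, 0 < s n := fun n => Nat.one_div_pos_of_nat
  have hne : ∀ n e, ∃ w, w ∈ subdiff (fun S => F S e) (z + s n • d) :=
    fun n e => aux_subdiff_nonempty _ (hsub e) (hEmpty e) _
  choose W hW using hne
  have hK : IsCompact (Set.pi Set.univ fun e : E => basePolytope (fun S => F S e)) :=
    isCompact_univ_pi fun e => aux_compact _
  obtain ⟨w, hw, φ, hφ, hlim⟩ := hK.tendsto_subseq (x := W) (fun n e _ => (hW n e).1)
  have ht0 : Tendsto (fun n => s (φ n)) atTop (𝓝 0) := hs0.comp hφ.tendsto_atTop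
  have hlim' : ∀ e v, Tendsto (fun n => W (φ n) e v) atTop (𝓝 (w e v)) := by
    intro e v
    exact (tendsto_pi_nhds.1 ((tendsto_pi_nhds.1 hlim) e)) v
  have hx : ∀ v, Tendsto (fun n => (z + s (φ n) • d) v) atTop (𝓝 (z v)) := by
    intro v
    have : Tendsto (fun n => z v + s (φ n) * d v) atTop (𝓝 (z v + 0 * d v)) :=
      tendsto_const_nhds.add (ht0.mul tendsto_const_nhds)
    simpa using this
  have hwe : ∀ e, w e ∈ subdiff (fun S => F S e) z := by
    intro e
    refine ⟨hw e (Set.mem_univ e), fun w' hw' => ?_⟩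
    refine le_of_tendsto_of_tendsto'
      (tendsto_finsetSum Finset.univ fun v _ => (tendsto_const_nhds (x := w' v)).mul (hx v))
      (tendsto_finsetSum Finset.univ fun v _ => (hlim' e v).mul (hx v)) ?_
    intro n
    exact (hW (φ n) e).2 w' hw'
  refine ⟨w, fun n => s (φ n), hwe, fun n => hspos _, ht0, fun e => ?_⟩
  have lin : ∀ (u : V → ℝ) (t : ℝ), ∑ v, u v * (z + t • d) v
      = ∑ v, u v * z v + t * ∑ v, u v * d v := by
    intro u t
    rw [Finset.mul_sum, ← Finset.sum_add_distrib]
    refine Finset.sum_congr rfl fun v _ => ?_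
    simp only [Pi.smul_apply, Pi.add_apply, smul_eq_mul]; ring
  refine tendsto_of_tendsto_of_tendsto_of_le_of_le
    (tendsto_const_nhds (x := ∑ v, w e v * d v))
    (tendsto_finsetSum Finset.univ fun v _ => (hlim' e v).mul (tendsto_const_nhds (x := d v))) ?_ ?_
  · intro n
    show _ ≤ _
    rw [le_div_iff₀ (hspos _)]
    have h1 := aux_le_lovasz _ (hsub e) (hEmpty e) (z + s (φ n) • d) (w e) (hwe e).1
    rw [lin] at h1
    rw [aux_lovasz_eq _ z _ (hwe e)]
    linarith
  · intro n
    show _ ≤ _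
    rw [div_le_iff₀ (hspos _)]
    have h1 := aux_le_lovasz _ (hsub e) (hEmpty e) z (W (φ n) e) (hW (φ n) e).1
    rw [aux_lovasz_eq _ _ _ (hW (φ n) e), lin]
    linarith

theorem aux_min {V E : Type*} [Fintype V] [DecidableEq V] [Fintype E]
    (F : Finset V → E → ℝ) (hcard : 2 ≤ Fintype.card V)
    (hsub : ∀ e : E, Submodular (fun S => F S e))
    (hEmpty : ∀ e : E, F ∅ e = 0) :
    ∃ z : V → ℝ, ∑ v, z v = 0 ∧ ∑ v, z v ^ 2 = 1 ∧ ∀ x : V → ℝ, ∑ v, x v = 0 →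
      (∑ e, lovasz (fun S => F S e) z ^ 2) * ∑ v, x v ^ 2
        ≤ ∑ e, lovasz (fun S => F S e) x ^ 2 := by
  let K : Set (V → ℝ) := {x | ∑ v, x v = 0 ∧ ∑ v, x v ^ 2 = 1}
  have hsc : ∀ x : V → ℝ, x ≠ 0 → 0 < ∑ v, x v ^ 2 := by
    intro x hx
    obtain ⟨v, hv⟩ := Function.ne_iff.1 hx
    exact Finset.sum_pos' (fun v _ => sq_nonneg _) ⟨v, Finset.mem_univ v, by
      have : x v ≠ 0 := hv
      positivity⟩
  have hKscale : ∀ x : V → ℝ, ∑ v, x v = 0 → x ≠ 0 →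
      (Real.sqrt (∑ v, x v ^ 2))⁻¹ • x ∈ K := by
    intro x hx h0
    have hp := hsc x h0
    constructor
    · simp only [Pi.smul_apply, smul_eq_mul]
      rw [← Finset.mul_sum, hx, mul_zero]
    · simp only [Pi.smul_apply, smul_eq_mul, mul_pow]
      rw [← Finset.mul_sum, inv_pow, Real.sq_sqrt hp.le, inv_mul_cancel₀ hp.ne']
  have hKc : IsCompact K := by
    refine IsCompact.of_isClosed_subset (isCompact_univ_pi (s := fun _ : V =>
      Set.Icc (-1 : ℝ) 1) fun v => isCompact_Icc) ?_ ?_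
    · exact (isClosed_eq (by fun_prop) continuous_const).inter
        (isClosed_eq (by fun_prop) continuous_const)
    · rintro x ⟨_, hx⟩ v _
      have : x v ^ 2 ≤ 1 := by
        rw [← hx]
        exact Finset.single_le_sum (f := fun v => x v ^ 2) (fun v _ => sq_nonneg _)
          (Finset.mem_univ v)
      exact abs_le.1 ((sq_le_one_iff_abs_le_one _).1 this)
  have hKne : K.Nonempty := by
    obtain ⟨a, b, hab⟩ := Fintype.exists_pair_of_one_lt_card (α := V) (by omega)
    refine ⟨_, hKscale (Pi.single a 1 - Pi.single b 1) ?_ ?_⟩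
    · simp [Finset.sum_sub_distrib]
    · intro h
      have := congrFun h a
      simp [hab] at this
  have hc : Continuous fun x : V → ℝ => ∑ e, lovasz (fun S => F S e) x ^ 2 := by
    refine continuous_finsetSum _ fun e _ => ?_
    exact (aux_lovasz_cont _).pow 2
  obtain ⟨z, hz, hm⟩ := hKc.exists_isMinOn hKne hc.continuousOn
  refine ⟨z, hz.1, hz.2, fun x hx => ?_⟩
  by_cases h0 : x = 0
  · subst h0
    simp only [Pi.zero_apply]
    simp
    exact Finset.sum_nonneg fun e _ => sq_nonneg _
  · have hp := hsc x h0
    have h1 := hm (hKscale x hx h0)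
    simp only [Set.mem_ofPred_eq] at h1
    have h2 : ∑ e, lovasz (fun S => F S e) ((Real.sqrt (∑ v, x v ^ 2))⁻¹ • x) ^ 2
        = (∑ v, x v ^ 2)⁻¹ * ∑ e, lovasz (fun S => F S e) x ^ 2 := by
      rw [Finset.mul_sum]
      refine Finset.sum_congr rfl fun e _ => ?_
      rw [aux_lovasz_smul _ (hsub e) (hEmpty e) _ _ (by positivity), mul_pow, inv_pow,
        Real.sq_sqrt hp.le]
    rw [h2, inv_mul_eq_div, le_div_iff₀ hp] at h1
    exact h1

open Filter Topology in
theorem aux_exists {V E : Type*} [Fintype V] [DecidableEq V] [Fintype E]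
    (F : Finset V → E → ℝ)
    (hcard : 2 ≤ Fintype.card V)
    (hsub : ∀ e : E, Submodular (fun S => F S e))
    (hEmpty : ∀ e : E, F ∅ e = 0)
    (hUniv : ∀ e : E, F Finset.univ e = 0) :
    ∃ (γ : ℝ) (z : V → ℝ), 0 ≤ γ ∧ z ≠ 0 ∧ (∑ v, z v) = 0 ∧ γ • z ∈ laplacian F z := by
  obtain ⟨z, hz0, hz1, hmin⟩ := aux_min F hcard hsub hEmpty
  set γ := ∑ e, lovasz (fun S => F S e) z ^ 2 with hγ
  refine ⟨γ, z, Finset.sum_nonneg fun e _ => sq_nonneg _, ?_, hz0, ?_⟩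
  · rintro rfl
    simp at hz1
  by_contra hnot
  let T : (E → V → ℝ) →ₗ[ℝ] (V → ℝ) :=
    ∑ e, lovasz (fun S => F S e) z • LinearMap.proj e
  have hT : ∀ w v, T w v = ∑ e, lovasz (fun S => F S e) z * w e v := by
    intro w v
    simp [T, LinearMap.sum_apply]
  let P : Set (E → V → ℝ) := Set.pi Set.univ fun e => subdiff (fun S => F S e) z
  have hL : laplacian F z = T '' P := by
    ext l
    constructor
    · rintro ⟨w, hw, rfl⟩
      refine ⟨w, fun e _ => hw e, ?_⟩
      funext v
      rw [hT]
      exact Finset.sum_congr rfl fun e _ => by rw [aux_lovasz_eq _ z _ (hw e)]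
    · rintro ⟨w, hw, rfl⟩
      refine ⟨w, fun e => hw e (Set.mem_univ e), ?_⟩
      funext v
      rw [hT]
      exact Finset.sum_congr rfl fun e _ => by
        rw [aux_lovasz_eq _ z _ (hw e (Set.mem_univ e))]
  have hPc : IsCompact P := isCompact_univ_pi fun e => aux_subdiff_compact _ _
  have hPv : Convex ℝ P := convex_pi fun e _ => aux_subdiff_convex _ _
  have hLc : IsClosed (laplacian F z) := by
    rw [hL]
    exact (hPc.image T.continuous_of_finiteDimensional).isClosed
  have hLv : Convex ℝ (laplacian F z) := by
    rw [hL]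
    exact hPv.linear_image T
  obtain ⟨f, u, hfu, hux⟩ := geometric_hahn_banach_closed_point hLv hLc hnot
  let d0 : V → ℝ := fun v => f (Pi.single v 1)
  have hf : ∀ x : V → ℝ, f x = ∑ v, x v * d0 v := by
    intro x
    conv_lhs => rw [pi_eq_sum_univ' x]
    simp only [map_sum, map_smul, smul_eq_mul]
    refine Finset.sum_congr rfl fun v _ => ?_
    congr 2
  let c : ℝ := (∑ v, d0 v) / Fintype.card V
  let d : V → ℝ := fun v => d0 v - c
  have hd : ∑ v, d v = 0 := by
    have : (Fintype.card V : ℝ) ≠ 0 := by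
      have : 0 < Fintype.card V := by omega
      positivity
    simp only [d, c, Finset.sum_sub_distrib, Finset.sum_const, Finset.card_univ, nsmul_eq_mul]
    field_simp
    ring
  have hdd : ∀ x : V → ℝ, ∑ v, x v = 0 → ∑ v, x v * d v = f x := by
    intro x hx
    simp only [d, mul_sub, Finset.sum_sub_distrib, ← Finset.sum_mul, hx, hf]
    ring
  obtain ⟨w, t, hw, htpos, ht0, hlim⟩ := aux_seq F hsub hEmpty z d
  have hTw : T w ∈ laplacian F z := by
    rw [hL]; exact ⟨w, fun e _ => hw e, rfl⟩
  have hlt : f (T w) < f (γ • z) := (hfu _ hTw).trans hux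
  have hTd : f (T w) = ∑ e, lovasz (fun S => F S e) z * ∑ v, w e v * d v := by
    rw [← hdd]
    · simp only [hT, Finset.sum_mul]
      rw [Finset.sum_comm]
      refine Finset.sum_congr rfl fun e _ => ?_
      rw [Finset.mul_sum]
      exact Finset.sum_congr rfl fun v _ => by ring
    · simp only [hT]
      rw [Finset.sum_comm]
      refine Finset.sum_eq_zero fun e _ => ?_
      rw [← Finset.mul_sum, (hw e).1.2]
      simp only [hUniv, mul_zero]
  have hzd : f (γ • z) = γ * ∑ v, z v * d v := by
    rw [hdd z hz0, map_smul, smul_eq_mul]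
  have hsq : ∀ s : ℝ, ∑ v, (z + s • d) v ^ 2
      = 1 + s * (2 * ∑ v, z v * d v + s * ∑ v, d v ^ 2) := by
    intro s
    rw [← hz1]
    simp only [Finset.mul_sum, ← Finset.sum_add_distrib]
    refine Finset.sum_congr rfl fun v _ => ?_
    simp only [Pi.smul_apply, Pi.add_apply, smul_eq_mul]; ring
  have hbt : ∀ e, Tendsto (fun n => lovasz (fun S => F S e) (z + t n • d)) atTop
      (𝓝 (lovasz (fun S => F S e) z)) := by
    intro e
    refine ((aux_lovasz_cont _).tendsto z).comp ?_
    have : Tendsto (fun n => z + t n • d) atTop (𝓝 (z + (0 : ℝ) • d)) :=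
      tendsto_const_nhds.add (ht0.smul tendsto_const_nhds)
    simpa using this
  have hL1 : Tendsto (fun n => ∑ e, ((lovasz (fun S => F S e) (z + t n • d)
        - lovasz (fun S => F S e) z) / t n) * (lovasz (fun S => F S e) (z + t n • d)
        + lovasz (fun S => F S e) z)) atTop
      (𝓝 (∑ e, (∑ v, w e v * d v) *
        (lovasz (fun S => F S e) z + lovasz (fun S => F S e) z))) :=
    tendsto_finsetSum _ fun e _ => (hlim e).mul ((hbt e).add tendsto_const_nhds)
  have hL2 : Tendsto (fun n => γ * (2 * ∑ v, z v * d v + t n * ∑ v, d v ^ 2)) atTop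
      (𝓝 (γ * (2 * ∑ v, z v * d v + 0 * ∑ v, d v ^ 2))) :=
    tendsto_const_nhds.mul (tendsto_const_nhds.add (ht0.mul tendsto_const_nhds))
  have hfin := le_of_tendsto_of_tendsto' hL2 hL1 (by
    intro n
    have hm := hmin (z + t n • d) (by
      simp only [Pi.smul_apply, Pi.add_apply, smul_eq_mul, Finset.sum_add_distrib,
        ← Finset.mul_sum, hz0, hd]
      ring)
    rw [hsq] at hm
    have htn := htpos n
    have e1 : ∑ e, ((lovasz (fun S => F S e) (z + t n • d)
        - lovasz (fun S => F S e) z) / t n) * (lovasz (fun S => F S e) (z + t n • d)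
        + lovasz (fun S => F S e) z)
        = (∑ e, lovasz (fun S => F S e) (z + t n • d) ^ 2 - γ) / t n := by
      rw [hγ, ← Finset.sum_sub_distrib, Finset.sum_div]
      exact Finset.sum_congr rfl fun e _ => by ring
    rw [e1, le_div_iff₀ htn]
    linarith)
  have e2 : ∑ e, (∑ v, w e v * d v) *
        (lovasz (fun S => F S e) z + lovasz (fun S => F S e) z) = 2 * f (T w) := by
    rw [hTd, Finset.mul_sum]
    exact Finset.sum_congr rfl fun e _ => by ring
  rw [e2] at hfin
  rw [hzd] at hlt
  linarith

/-- **Non-trivial eigenpairs of the submodular Laplacian** (Theorem 3.6).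
The Laplacian `L_F` of a submodular transformation with `F(∅) = F(V) = 0` on `|V| ≥ 2`
has a non-trivial eigenpair, and every non-trivial eigenpair `(γ, z)` satisfies
`γ = R_F(z) = (∑_e f_e(z)²) / ‖z‖₂²`. -/
theorem laplacian_nontrivial_eigenpair
    {V E : Type*} [Fintype V] [DecidableEq V] [Fintype E]
    (F : Finset V → E → ℝ)
    (hcard : 2 ≤ Fintype.card V)
    (hsub : ∀ e : E, Submodular (fun S => F S e))
    (hEmpty : ∀ e : E, F ∅ e = 0)
    (hUniv : ∀ e : E, F Finset.univ e = 0) :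
    (∃ (γ : ℝ) (z : V → ℝ), 0 ≤ γ ∧ z ≠ 0 ∧ (∑ v, z v) = 0 ∧ γ • z ∈ laplacian F z) ∧
    (∀ (γ : ℝ) (z : V → ℝ), z ≠ 0 → (∑ v, z v) = 0 → γ • z ∈ laplacian F z →
      γ = (∑ e : E, (lovasz (fun S => F S e) z)^2) / (∑ v, (z v)^2)) := by
  refine ⟨aux_exists F hcard hsub hEmpty hUniv, ?_⟩
  rintro γ z hz hz0 ⟨w, hw, he⟩
  have hp : 0 < ∑ v, z v ^ 2 := by
    obtain ⟨v, hv⟩ := Function.ne_iff.1 hz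
    exact Finset.sum_pos' (fun v _ => sq_nonneg _) ⟨v, Finset.mem_univ v, by
      have : z v ≠ 0 := hv
      positivity⟩
  rw [eq_div_iff hp.ne']
  have h1 : ∀ v, γ * z v = ∑ e : E, (∑ u, w e u * z u) * w e v := by
    intro v
    simpa using congrFun he v
  calc γ * ∑ v, z v ^ 2 = ∑ v, (γ * z v) * z v := by
        rw [Finset.mul_sum]; exact Finset.sum_congr rfl fun v _ => by ring
    _ = ∑ v, ∑ e : E, (∑ u, w e u * z u) * (w e v * z v) := by
        refine Finset.sum_congr rfl fun v _ => ?_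
        rw [h1, Finset.sum_mul]
        exact Finset.sum_congr rfl fun e _ => by ring
    _ = ∑ e : E, (lovasz (fun S => F S e) z)^2 := by
        rw [Finset.sum_comm]
        refine Finset.sum_congr rfl fun e _ => ?_
        rw [← Finset.mul_sum, aux_lovasz_eq _ z _ (hw e), sq]
end

section
/- Let F : 2^V → ℝ^E be a submodular transformation on a finite set V with |V| ≥ 2 such that F(∅) = 0, F(V) = 0, F_e(S) ≥ 0 for all e ∈ E and S ⊆ V, and d_F(v) > 0 for all v ∈ V. Then for every nonzero x ∈ ℝ^V with ⟨x, D_F^{1/2} 1⟩ = 0, there exists a set S with ∅ ⊊ S ⊊ V such that φ_F(S) ≤ 2 √(ℛ_F(x)). -/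
open Finset

variable {V E : Type*}

theorem abel_nonneg (G z : ℕ → ℝ) (n : ℕ) (h0 : G 0 = 0) (hn : G n = 0)
    (hG : ∀ i, i ≤ n → 0 ≤ G i) (hz : Monotone z) :
    0 ≤ ∑ i ∈ Finset.range n, (G i - G (i+1)) * z i := by
  have key : ∀ k, k ≤ n → -(G k * z k) ≤ ∑ i ∈ Finset.range k, (G i - G (i+1)) * z i := by
    intro k
    induction k with
    | zero => intro _; simp [h0]
    | succ k ih =>
      intro hk
      rw [Finset.sum_range_succ]
      have h1 := ih (by omega)
      have h2 := hG (k+1) hk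
      have h3 := hz (Nat.le_succ k)
      have h4 := mul_le_mul_of_nonneg_left h3 h2
      simp only [Nat.succ_eq_add_one] at h4
      linarith
  have := key n le_rfl
  simpa [hn] using this

theorem exists_order {V : Type*} [Fintype V] [DecidableEq V] [Nonempty V] (y : V → ℝ) :
    ∃ (s : ℕ → V) (r : V → ℕ), (∀ v, r v < Fintype.card V) ∧ (∀ v, s (r v) = v) ∧
      (∀ i, i < Fintype.card V → r (s i) = i) ∧ Monotone (fun i => y (s i)) ∧
      (∀ h : V → ℝ, ∑ v, h v = ∑ i ∈ Finset.range (Fintype.card V), h (s i)) := by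
  have hpos : 0 < Fintype.card V := Fintype.card_pos
  let e := Fintype.equivFin V
  let τ := Tuple.sort (y ∘ e.symm)
  have hτ : Monotone ((y ∘ e.symm) ∘ τ) := Tuple.monotone_sort _
  let σ : Fin (Fintype.card V) ≃ V := τ.trans e.symm
  let s : ℕ → V := fun i => σ ⟨min i (Fintype.card V - 1), by omega⟩
  have hs : ∀ i (hi : i < Fintype.card V), s i = σ ⟨i, hi⟩ := by
    intro i hi
    simp only [s]
    congr 2
    omega
  refine ⟨s, fun v => (σ.symm v : ℕ), fun v => (σ.symm v).2, ?_, ?_, ?_, ?_⟩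
  · intro v
    rw [hs _ (σ.symm v).2]; simp
  · intro i hi
    rw [hs i hi]; simp
  · intro i j hij
    have : (⟨min i (Fintype.card V - 1), by omega⟩ : Fin (Fintype.card V)) ≤
        ⟨min j (Fintype.card V - 1), by omega⟩ := by
      simp only [Fin.mk_le_mk]; omega
    exact hτ this
  · intro h
    rw [Finset.sum_range, ← Equiv.sum_comp σ]
    exact Finset.sum_congr rfl (fun i _ => by rw [hs i i.2])

/-- upper level sets of a ranking -/
def upSet {V : Type*} [Fintype V] (r : V → ℕ) (i : ℕ) : Finset V :=
  Finset.univ.filter (fun v => i ≤ r v)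

theorem upSet_insert {V : Type*} [Fintype V] [DecidableEq V] (r : V → ℕ) (hr : Function.Injective r)
    (v : V) : insert v (upSet r (r v + 1)) = upSet r (r v) := by
  ext u
  simp only [upSet, Finset.mem_insert, Finset.mem_filter, Finset.mem_univ, true_and]
  constructor
  · rintro (rfl | h)
    · exact le_rfl
    · omega
  · intro h
    rcases Nat.lt_or_ge (r v) (r u) with h' | h'
    · right; omega
    · left; exact hr (by omega)

theorem notMem_upSet {V : Type*} [Fintype V] (r : V → ℕ) (v : V) : v ∉ upSet r (r v + 1) := by
  simp [upSet]

/-- greedy vector -/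
def greedy {V : Type*} [Fintype V] (G : Finset V → ℝ) (r : V → ℕ) (v : V) : ℝ :=
  G (upSet r (r v)) - G (upSet r (r v + 1))

theorem greedy_mem {V : Type*} [Fintype V] [DecidableEq V] (G : Finset V → ℝ)
    (hsub : Submodular G) (h0 : G ∅ = 0) (s : ℕ → V) (r : V → ℕ)
    (hlt : ∀ v, r v < Fintype.card V) (hsr : ∀ v, s (r v) = v)
    (hrs : ∀ i, i < Fintype.card V → r (s i) = i)
    (hsum : ∀ h : V → ℝ, ∑ v, h v = ∑ i ∈ Finset.range (Fintype.card V), h (s i)) :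
    greedy G r ∈ basePolytope G := by
  have hr : Function.Injective r := fun a b h => by rw [← hsr a, h, hsr]
  have hU0 : upSet r 0 = Finset.univ := by simp [upSet]
  have hUn : upSet r (Fintype.card V) = ∅ := by
    ext v; simp [upSet, hlt v]
  constructor
  · intro S
    have h1 : ∑ v ∈ S, greedy G r v = ∑ v, if v ∈ S then greedy G r v else 0 := by
      simp
    rw [h1]
    have h2 : ∀ v, (if v ∈ S then greedy G r v else 0) ≤
        G (S ∩ upSet r (r v)) - G (S ∩ upSet r (r v + 1)) := by
      intro v
      have hi := upSet_insert r hr v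
      have hm := notMem_upSet r v
      split_ifs with hv
      · have := hsub (S ∩ upSet r (r v)) (upSet r (r v + 1))
        have e1 : (S ∩ upSet r (r v)) ∪ upSet r (r v + 1) = upSet r (r v) := by
          rw [← hi]; ext u; simp only [Finset.mem_union, Finset.mem_inter, Finset.mem_insert]
          constructor
          · tauto
          · rintro (rfl | h) <;> tauto
        have e2 : (S ∩ upSet r (r v)) ∩ upSet r (r v + 1) = S ∩ upSet r (r v + 1) := by
          rw [← hi]; ext u; simp only [Finset.mem_inter, Finset.mem_insert]
          tauto
        rw [e1, e2] at this
        unfold greedy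
        linarith
      · have e : S ∩ upSet r (r v) = S ∩ upSet r (r v + 1) := by
          rw [← hi, Finset.inter_insert_of_notMem hv]
        rw [e]; simp
    refine (Finset.sum_le_sum (fun v _ => h2 v)).trans ?_
    rw [hsum]
    have h3 : ∑ i ∈ Finset.range (Fintype.card V),
        (G (S ∩ upSet r (r (s i))) - G (S ∩ upSet r (r (s i) + 1))) =
        ∑ i ∈ Finset.range (Fintype.card V),
        (G (S ∩ upSet r i) - G (S ∩ upSet r (i + 1))) :=
      Finset.sum_congr rfl (fun i hi => by rw [hrs i (Finset.mem_range.1 hi)])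
    rw [h3, Finset.sum_range_sub', hU0, hUn]
    simp [h0]
  · rw [hsum]
    have h3 : ∑ i ∈ Finset.range (Fintype.card V), greedy G r (s i) =
        ∑ i ∈ Finset.range (Fintype.card V), (G (upSet r i) - G (upSet r (i + 1))) :=
      Finset.sum_congr rfl (fun i hi => by unfold greedy; rw [hrs i (Finset.mem_range.1 hi)])
    rw [h3, Finset.sum_range_sub', hU0, hUn, h0, sub_zero]

theorem le_lovasz {V : Type*} [Fintype V] [DecidableEq V] (G : Finset V → ℝ) (w y : V → ℝ)
    (hw : w ∈ basePolytope G) : ∑ v, w v * y v ≤ lovasz G y := by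
  apply le_csSup
  · refine ⟨∑ v, (|G {v}| + |G Finset.univ - G {v}ᶜ|) * |y v|, ?_⟩
    rintro _ ⟨u, hu, rfl⟩
    apply Finset.sum_le_sum
    intro v _
    have h1 := hu.1 {v}
    have h2 := hu.1 {v}ᶜ
    have h3 := Finset.sum_add_sum_compl {v} u
    rw [hu.2] at h3
    simp only [Finset.sum_singleton] at h1 h3
    have h4 : |u v| ≤ |G {v}| + |G Finset.univ - G {v}ᶜ| := by
      rw [abs_le]
      have a1 := le_abs_self (G {v})
      have a2 := neg_abs_le (G Finset.univ - G {v}ᶜ)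
      have a3 := abs_nonneg (G {v})
      have a4 := abs_nonneg (G Finset.univ - G {v}ᶜ)
      constructor <;> linarith
    calc u v * y v ≤ |u v * y v| := le_abs_self _
      _ = |u v| * |y v| := abs_mul _ _
      _ ≤ _ := mul_le_mul_of_nonneg_right h4 (abs_nonneg _)
  · exact ⟨w, hw, rfl⟩

theorem sq_mono (M : ℝ) (a b : ℝ) (hab : a ≤ b) :
    2 * M * (max (-M) (min M a)) - (max (-M) (min M a)) * |max (-M) (min M a)| ≤
    2 * M * (max (-M) (min M b)) - (max (-M) (min M b)) * |max (-M) (min M b)| := by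
  rcases lt_or_ge M 0 with hM | hM
  · have ha : max (-M) (min M a) = -M :=
      max_eq_left ((min_le_left _ _).trans (by linarith))
    have hb : max (-M) (min M b) = -M :=
      max_eq_left ((min_le_left _ _).trans (by linarith))
    rw [ha, hb]
  have h : max (-M) (min M a) ≤ max (-M) (min M b) :=
    max_le_max le_rfl (min_le_min le_rfl hab)
  have ha1 : -M ≤ max (-M) (min M a) := le_max_left _ _
  have hb1 : max (-M) (min M b) ≤ M := max_le (by linarith) (min_le_left _ _)
  generalize max (-M) (min M a) = p at *
  generalize max (-M) (min M b) = q at *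
  rcases abs_cases p with ⟨e, h1⟩ | ⟨e, h1⟩ <;> rcases abs_cases q with ⟨e', h2⟩ | ⟨e', h2⟩ <;>
    rw [e, e'] <;> nlinarith

/-- Per-coordinate bound. -/
theorem greedy_bound {V : Type*} [Fintype V] [DecidableEq V] (G : Finset V → ℝ)
    (h0 : G ∅ = 0) (h1 : G Finset.univ = 0) (hG : ∀ S, 0 ≤ G S) (s : ℕ → V) (r : V → ℕ)
    (hlt : ∀ v, r v < Fintype.card V) (hsr : ∀ v, s (r v) = v)
    (hrs : ∀ i, i < Fintype.card V → r (s i) = i)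
    (hsum : ∀ h : V → ℝ, ∑ v, h v = ∑ i ∈ Finset.range (Fintype.card V), h (s i))
    (y : V → ℝ) (hy : Monotone (fun i => y (s i))) (M : ℝ)
    (hM : ∀ v ∈ funSupp G, |y v| ≤ M) :
    ∑ v, greedy G r v * (y v * |y v|) ≤ 2 * M * ∑ v, greedy G r v * y v := by
  have hr : Function.Injective r := fun a b h => by rw [← hsr a, h, hsr]
  have hU0 : upSet r 0 = Finset.univ := by simp [upSet]
  have hUn : upSet r (Fintype.card V) = ∅ := by
    ext v; simp [upSet, hlt v]
  have key := abel_nonneg (fun i => G (upSet r i))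
    (fun i => 2 * M * (max (-M) (min M (y (s i)))) -
      (max (-M) (min M (y (s i)))) * |max (-M) (min M (y (s i)))|) (Fintype.card V)
    (by simp [hU0, h1]) (by simp [hUn, h0]) (fun i _ => hG _)
    (fun i j hij => sq_mono M _ _ (hy hij))
  have e : ∑ v, greedy G r v * (2 * M * y v - y v * |y v|) =
      ∑ v, greedy G r v * (2 * M * (max (-M) (min M (y v))) -
      (max (-M) (min M (y v))) * |max (-M) (min M (y v))|) := by
    apply Finset.sum_congr rfl
    intro v _
    by_cases hv : v ∈ funSupp G
    · have := abs_le.1 (hM v hv)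
      rw [min_eq_right this.2, max_eq_right this.1]
    · have : greedy G r v = 0 := by
        by_contra hne
        apply hv
        refine ⟨upSet r (r v + 1), notMem_upSet r v, ?_⟩
        rw [upSet_insert r hr v]
        exact sub_ne_zero.1 hne
      simp [this]
  have e2 : ∑ v, greedy G r v * (2 * M * y v - y v * |y v|) =
      2 * M * ∑ v, greedy G r v * y v - ∑ v, greedy G r v * (y v * |y v|) := by
    rw [Finset.mul_sum, ← Finset.sum_sub_distrib]
    exact Finset.sum_congr rfl (fun v _ => by ring)
  rw [← sub_nonneg, ← e2, e, hsum]
  refine key.trans_eq (Finset.sum_congr rfl (fun i hi => ?_))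
  unfold greedy
  rw [hrs i (Finset.mem_range.1 hi)]

/-- Median and lower bound. -/
theorem lower_bound {V : Type*} [Fintype V] [DecidableEq V] (C : Finset V → ℝ)
    (d : V → ℝ) (hd : ∀ v, 0 < d v) [Nonempty V]
    (h0 : C ∅ = 0) (h1 : C Finset.univ = 0) (φ : ℝ)
    (hC : ∀ S, φ * min (∑ v ∈ S, d v) (∑ v ∈ Sᶜ, d v) ≤ C S) (s : ℕ → V) (r : V → ℕ)
    (hlt : ∀ v, r v < Fintype.card V) (hsr : ∀ v, s (r v) = v)
    (hrs : ∀ i, i < Fintype.card V → r (s i) = i)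
    (hsum : ∀ h : V → ℝ, ∑ v, h v = ∑ i ∈ Finset.range (Fintype.card V), h (s i))
    (y : V → ℝ) (hy : Monotone (fun i => y (s i))) :
    ∃ c : ℝ, φ * ∑ v, d v * (y v - c) ^ 2 ≤
      ∑ v, greedy C r v * ((y v - c) * |y v - c|) := by
  have hr : Function.Injective r := fun a b h => by rw [← hsr a, h, hsr]
  have hU0 : upSet r 0 = Finset.univ := by simp [upSet]
  have hUn : upSet r (Fintype.card V) = ∅ := by
    ext v; simp [upSet, hlt v]
  set T := ∑ v, d v with hT
  have hTpos : 0 < T := Finset.sum_pos (fun v _ => hd v) Finset.univ_nonempty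
  let vol : ℕ → ℝ := fun i => ∑ v ∈ upSet r i, d v
  have hvol0 : vol 0 = T := by simp [vol, hU0, hT]
  have hvoln : vol (Fintype.card V) = 0 := by simp [vol, hUn]
  have hcompl : ∀ i, ∑ v ∈ (upSet r i)ᶜ, d v = T - vol i := by
    intro i
    have := Finset.sum_add_sum_compl (upSet r i) d
    simp only [vol, hT]; linarith
  have hanti : Antitone vol := by
    intro i j hij
    apply Finset.sum_le_sum_of_subset_of_nonneg
    · intro v; simp only [upSet, Finset.mem_filter, Finset.mem_univ, true_and]; omega
    · intro v _ _; exact (hd v).le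
  have hstep : ∀ v, vol (r v) - vol (r v + 1) = d v := by
    intro v
    simp only [vol]
    rw [← upSet_insert r hr v, Finset.sum_insert (notMem_upSet r v)]
    ring
  have hex : ∃ k, 2 * vol k < T := ⟨Fintype.card V, by rw [hvoln]; linarith⟩
  classical
  obtain ⟨k, hk, hkmin⟩ : ∃ k, 2 * vol k < T ∧ ∀ i < k, T ≤ 2 * vol i :=
    ⟨Nat.find hex, Nat.find_spec hex, fun i hi => not_lt.1 (Nat.find_min hex hi)⟩
  have hkpos : 0 < k := by
    rcases Nat.eq_zero_or_pos k with h | h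
    · subst h; rw [hvol0] at hk; linarith
    · exact h
  let m := k - 1
  refine ⟨y (s m), ?_⟩
  let μ : ℕ → ℝ := fun i => min (vol i) (T - vol i)
  have hμlo : ∀ i, i ≤ m → μ i = T - vol i := by
    intro i hi
    have := hkmin i (by omega)
    exact min_eq_right (by linarith)
  have hμhi : ∀ i, m < i → μ i = vol i := by
    intro i hi
    have : vol i ≤ vol k := hanti (by omega)
    exact min_eq_left (by linarith)
  have hz : Monotone (fun i => (y (s i) - y (s m)) * |y (s i) - y (s m)|) := by
    intro i j hij
    have h : y (s i) - y (s m) ≤ y (s j) - y (s m) := sub_le_sub_right (hy hij) _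
    simp only
    generalize y (s i) - y (s m) = p at *
    generalize y (s j) - y (s m) = q at *
    rcases abs_cases p with ⟨e, h1⟩ | ⟨e, h1⟩ <;> rcases abs_cases q with ⟨e', h2⟩ | ⟨e', h2⟩ <;>
      rw [e, e'] <;> nlinarith
  have key := abel_nonneg (fun i => C (upSet r i) - φ * μ i) _ (Fintype.card V)
    (by simp [hU0, h1, μ, hvol0, hTpos.le]) (by simp [hUn, h0, μ, hvoln, hTpos.le])
    (fun i _ => by
      have := hC (upSet r i)
      rw [hcompl] at this
      simp only [μ, vol] at *
      linarith) hz
  rw [hsum, hsum, Finset.mul_sum, ← sub_nonneg, ← Finset.sum_sub_distrib]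
  refine key.trans_eq (Finset.sum_congr rfl (fun i hi => ?_))
  have hri := hrs i (Finset.mem_range.1 hi)
  have hst := hstep (s i)
  unfold greedy
  rw [hri] at *
  rcases lt_trichotomy i m with h | h | h
  · have h2 : y (s i) - y (s m) ≤ 0 := sub_nonpos.2 (hy h.le)
    rw [hμlo i h.le, hμlo (i+1) h, abs_of_nonpos h2, ← hst]
    ring
  · subst h; simp
  · have h2 : 0 ≤ y (s i) - y (s m) := sub_nonneg.2 (hy h.le)
    rw [hμhi i h, hμhi (i+1) (by omega), abs_of_nonneg h2, ← hst]
    ring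

/-- **Strong rounding** (Lemma 4.9). For a non-negative submodular transformation with
`F(∅) = F(V) = 0`, `|V| ≥ 2` and positive degrees, every nonzero `x` orthogonal to
`D_F^{1/2} 𝟏` yields a nonempty proper set `S` with `φ_F(S) ≤ 2 √(ℛ_F(x))`. -/
theorem strong_rounding
    {V E : Type*} [Fintype V] [DecidableEq V] [Fintype E]
    (F : Finset V → E → ℝ)
    (hcard : 2 ≤ Fintype.card V)
    (hsub : ∀ e : E, Submodular (fun S => F S e))
    (hEmpty : ∀ e : E, F ∅ e = 0)
    (hUniv : ∀ e : E, F Finset.univ e = 0)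
    (hNonneg : ∀ (e : E) (S : Finset V), 0 ≤ F S e)
    (hDeg : ∀ v : V, 0 < deg F v)
    (x : V → ℝ) (hx : x ≠ 0)
    (horth : (∑ v, x v * Real.sqrt (deg F v)) = 0) :
    ∃ S : Finset V, S.Nonempty ∧ S ≠ Finset.univ ∧
      condOf F S ≤ 2 * Real.sqrt (rayleigh F x) := by
  classical
  have hne : Nonempty V := Fintype.card_pos_iff.1 (by omega)
  have hnt : Nontrivial V := Fintype.one_lt_card_iff_nontrivial.1 (by omega)
  -- the minimizer
  obtain ⟨S, hS, hmin⟩ := Finset.exists_min_image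
    ((Finset.univ : Finset (Finset V)).filter (fun S => S.Nonempty ∧ S ≠ Finset.univ)) (condOf F)
    (by
      obtain ⟨a, b, hab⟩ := hnt
      refine ⟨{a}, ?_⟩
      simp only [Finset.mem_filter, Finset.mem_univ, true_and]
      refine ⟨Finset.singleton_nonempty a, fun h => hab ?_⟩
      have : b ∈ ({a} : Finset V) := h ▸ Finset.mem_univ b
      exact (Finset.mem_singleton.1 this).symm)
  simp only [Finset.mem_filter, Finset.mem_univ, true_and] at hS hmin
  refine ⟨S, hS.1, hS.2, ?_⟩
  set φ := condOf F S with hφ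
  have hcut : ∀ A, φ * min (∑ v ∈ A, deg F v) (∑ v ∈ Aᶜ, deg F v) ≤ cutF F A := by
    intro A
    have hcutn : 0 ≤ cutF F A := Finset.sum_nonneg (fun e _ => hNonneg e A)
    rcases Finset.eq_empty_or_nonempty A with rfl | hA
    · have : 0 ≤ ∑ v, deg F v := Finset.sum_nonneg (fun v _ => (hDeg v).le)
      simpa [min_eq_left this] using hcutn
    by_cases hA' : A = Finset.univ
    · subst hA'
      have : 0 ≤ ∑ v, deg F v := Finset.sum_nonneg (fun v _ => (hDeg v).le)
      simpa [min_eq_right this] using hcutn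
    have h := hmin A ⟨hA, hA'⟩
    have hAc : (Aᶜ).Nonempty := by
      rw [Finset.nonempty_iff_ne_empty]; simpa using hA'
    have hpos : 0 < min (volF F A) (volF F Aᶜ) :=
      lt_min (Finset.sum_pos (fun v _ => hDeg v) hA) (Finset.sum_pos (fun v _ => hDeg v) hAc)
    rw [condOf, le_div_iff₀ hpos] at h
    exact h.trans (min_le_left _ _)
  set y : V → ℝ := fun v => x v / Real.sqrt (deg F v) with hy
  obtain ⟨s, r, hlt, hsr, hrs, hmono, hsum⟩ := exists_order y
  obtain ⟨c, hc⟩ := lower_bound (cutF F) (deg F) hDeg (by simp [cutF, hEmpty])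
    (by simp [cutF, hUniv]) φ hcut s r hlt hsr hrs hsum y hmono
  set Y := ∑ v, deg F v * (y v - c) ^ 2 with hY
  set X := ∑ v, (x v) ^ 2 with hX
  set L := ∑ e : E, (lovasz (fun S => F S e) y) ^ 2 with hL
  have hsq : ∀ v, Real.sqrt (deg F v) ^ 2 = deg F v := fun v => Real.sq_sqrt (hDeg v).le
  have hsp : ∀ v, 0 < Real.sqrt (deg F v) := fun v => Real.sqrt_pos.2 (hDeg v)
  have hXpos : 0 < X := by
    obtain ⟨v, hv⟩ := Function.ne_iff.1 hx
    have hv' : x v ≠ 0 := hv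
    exact Finset.sum_pos' (fun v _ => sq_nonneg _) ⟨v, Finset.mem_univ v, by positivity⟩
  have hXY : X ≤ Y := by
    have e : Y = X - 2 * c * (∑ v, x v * Real.sqrt (deg F v)) + c ^ 2 * ∑ v, deg F v := by
      rw [hY, hX, Finset.mul_sum, Finset.mul_sum, ← Finset.sum_sub_distrib,
        ← Finset.sum_add_distrib]
      apply Finset.sum_congr rfl
      intro v _
      have h1 : x v = y v * Real.sqrt (deg F v) := by
        simp only [hy]; rw [div_mul_cancel₀ _ (hsp v).ne']
      rw [h1]
      have h2 := hsq v
      generalize Real.sqrt (deg F v) = t at *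
      rw [← h2]; ring
    have : 0 ≤ c ^ 2 * ∑ v, deg F v :=
      mul_nonneg (sq_nonneg _) (Finset.sum_nonneg (fun v _ => (hDeg v).le))
    rw [e, horth]; linarith
  have hYpos : 0 < Y := hXpos.trans_le hXY
  -- M
  let M2 : E → ℝ := fun e => ∑ v, if v ∈ funSupp (fun S => F S e) then (y v - c) ^ 2 else 0
  have hM2n : ∀ e, 0 ≤ M2 e := fun e => Finset.sum_nonneg (fun v _ => by split_ifs <;> positivity)
  have hM2 : ∑ e, M2 e = Y := by
    simp only [M2]
    rw [Finset.sum_comm, hY]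
    apply Finset.sum_congr rfl
    intro v _
    rw [← Finset.sum_filter, Finset.sum_const, nsmul_eq_mul, deg]
  have hper : ∀ e, ∑ v, greedy (fun S => F S e) r v * ((y v - c) * |y v - c|) ≤
      2 * (Real.sqrt (M2 e) * lovasz (fun S => F S e) y) := by
    intro e
    have h1 := greedy_bound (fun S => F S e) (hEmpty e) (hUniv e) (hNonneg e) s r hlt hsr hrs hsum
      (fun v => y v - c) (fun i j hij => sub_le_sub_right (hmono hij) c) (Real.sqrt (M2 e))
      (by
        intro v hv
        apply Real.abs_le_sqrt
        have := Finset.single_le_sum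
          (f := fun v => if v ∈ funSupp (fun S => F S e) then (y v - c) ^ 2 else 0)
          (fun v _ => by split_ifs <;> positivity) (Finset.mem_univ v)
        simpa [hv, M2] using this)
    have hmem := greedy_mem (fun S => F S e) (hsub e) (hEmpty e) s r hlt hsr hrs hsum
    have h2 := le_lovasz (fun S => F S e) _ y hmem
    have h3 : ∑ v, greedy (fun S => F S e) r v * (y v - c) =
        ∑ v, greedy (fun S => F S e) r v * y v := by
      have : ∑ v, greedy (fun S => F S e) r v = 0 := by rw [hmem.2]; exact hUniv e
      simp only [mul_sub, Finset.sum_sub_distrib, ← Finset.sum_mul, this]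
      simp
    rw [h3] at h1
    have h4 := mul_le_mul_of_nonneg_left h2 (Real.sqrt_nonneg (M2 e))
    linarith
  have htot : φ * Y ≤ 2 * ∑ e, Real.sqrt (M2 e) * lovasz (fun S => F S e) y := by
    refine hc.trans ?_
    have e1 : ∑ v, greedy (cutF F) r v * ((y v - c) * |y v - c|) =
        ∑ e, ∑ v, greedy (fun S => F S e) r v * ((y v - c) * |y v - c|) := by
      rw [Finset.sum_comm]
      apply Finset.sum_congr rfl
      intro v _
      rw [← Finset.sum_mul]
      simp only [greedy, cutF, Finset.sum_sub_distrib]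
    rw [e1, Finset.mul_sum]
    exact Finset.sum_le_sum (fun e _ => hper e)
  have hCS : ∑ e, Real.sqrt (M2 e) * lovasz (fun S => F S e) y ≤ Real.sqrt Y * Real.sqrt L := by
    have := Real.sum_mul_le_sqrt_mul_sqrt Finset.univ (fun e => Real.sqrt (M2 e))
      (fun e => lovasz (fun S => F S e) y)
    simpa only [Real.sq_sqrt (hM2n _), hM2] using this
  have hR : rayleigh F x = L / X := rfl
  have hLR : Real.sqrt L ≤ Real.sqrt Y * Real.sqrt (rayleigh F x) := by
    rw [← Real.sqrt_mul hYpos.le]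
    apply Real.sqrt_le_sqrt
    have hL0 : 0 ≤ L := Finset.sum_nonneg (fun e _ => sq_nonneg _)
    rw [hR, mul_div_assoc', le_div_iff₀ hXpos]
    nlinarith
  have hfin : φ * Y ≤ (2 * Real.sqrt (rayleigh F x)) * Y := by
    have h1 := mul_le_mul_of_nonneg_left hLR (Real.sqrt_nonneg Y)
    have h2 := Real.mul_self_sqrt hYpos.le
    have h3 : Real.sqrt Y * (Real.sqrt Y * Real.sqrt (rayleigh F x)) =
      Y * Real.sqrt (rayleigh F x) := by rw [← mul_assoc, h2]
    linarith
  exact le_of_mul_le_mul_right hfin hYpos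
end
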